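/- arXiv:2407.12218 — 4 statements merged into one kernel-verified Lean document; each statement's English description precedes it below -/
import Mathlib

section
/- Let F be the multivariate formal power series in variables x, t, q over ℚ whose coefficient of x^n t^d q^j is the number of full binary trees T with V(T) = n, D(T) = d and J(T) = j. Then F satisfies the quadratic equation (t·x·(q + t − 1) − t + 1)·F² + (t·x·(1 − q) + t − 2)·F + 1 = 0. (This quadratic equation is the polynomial form of the explicit radical expression F(x,t,q) = −(−qtx + tx + √(q²t²x² − 2qt²x² − 2qt²x + t²x² − 2t²x + t²) + t − 2)/(2(qtx + t²x − tx − t + 1)).) -/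
inductive BTree : Type
  | leaf : BTree
  | node : BTree → BTree → BTree

namespace BTree

/-- number of internal vertices -/
def V : BTree → ℕ
  | leaf => 0
  | node l r => V l + V r + 1

/-- depth of the rightmost leaf -/
def D : BTree → ℕ
  | leaf => 0
  | node _ r => 1 + D r

/-- number of jumps -/
def J : BTree → ℕ
  | leaf => 0
  | node leaf r => J r
  | node (node l₁ r₁) r => J (node l₁ r₁) + J r + 1

/-- sum of jump distances -/
def JD : BTree → ℕ
  | leaf => 0
  | node l r => JD l + JD r + D l

end BTree

namespace BTree

/-- generating function of a weight -/
noncomputable def gf {α : Type} (w : α → (Fin 3 →₀ ℕ)) : MvPowerSeries (Fin 3) ℚ :=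
  fun s => (Nat.card {a : α // w a = s} : ℚ)

/-- finite fibers -/
def FF {α : Type} (w : α → (Fin 3 →₀ ℕ)) : Prop := ∀ s, Finite {a : α // w a = s}

theorem coeff_gf {α : Type} (w : α → (Fin 3 →₀ ℕ)) (s) :
    MvPowerSeries.coeff s (gf w) = (Nat.card {a : α // w a = s} : ℚ) := rfl

theorem gf_prod {α β : Type} (w : α → (Fin 3 →₀ ℕ)) (v : β → (Fin 3 →₀ ℕ))
    (hw : FF w) (hv : FF v) :
    gf (fun p : α × β => w p.1 + v p.2) = gf w * gf v := by
  ext s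
  rw [MvPowerSeries.coeff_mul, coeff_gf]
  have e : {p : α × β // w p.1 + v p.2 = s} ≃
      Σ ij : {ij // ij ∈ Finset.HasAntidiagonal.antidiagonal s}, {a // w a = ij.1.1} × {b // v b = ij.1.2} :=
    { toFun := fun p => ⟨⟨(w p.1.1, v p.1.2), by simpa using p.2⟩, ⟨p.1.1, rfl⟩, ⟨p.1.2, rfl⟩⟩
      invFun := fun z => ⟨(z.2.1.1, z.2.2.1), by
        have := z.1.2
        rw [Finset.HasAntidiagonal.mem_antidiagonal] at this
        simp only [z.2.1.2, z.2.2.2, this]⟩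
      left_inv := fun p => rfl
      right_inv := by
        rintro ⟨⟨⟨i, j⟩, h⟩, ⟨a, ha⟩, ⟨b, hb⟩⟩
        dsimp only at ha hb
        subst ha hb
        rfl }
  have hw' : ∀ s, Finite {a // w a = s} := hw
  have hv' : ∀ s, Finite {a // v a = s} := hv
  rw [Nat.card_congr e, Nat.card_sigma]
  push_cast
  simp only [coeff_gf, Nat.card_prod, Nat.cast_mul]
  exact Finset.sum_coe_sort (Finset.HasAntidiagonal.antidiagonal s)
    (fun ij => (Nat.card {a // w a = ij.1} : ℚ) * (Nat.card {b // v b = ij.2} : ℚ))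

theorem gf_unit (m : Fin 3 →₀ ℕ) : gf (fun _ : Unit => m) = MvPowerSeries.monomial m 1 := by
  classical
  ext s
  rw [MvPowerSeries.coeff_monomial, coeff_gf]
  split_ifs with h
  · subst h; simp
  · have : IsEmpty {a : Unit // m = s} := ⟨fun a => h a.2.symm⟩
    simp

theorem gf_equiv {α β : Type} (e : α ≃ β) (w : α → (Fin 3 →₀ ℕ)) (v : β → (Fin 3 →₀ ℕ))
    (h : ∀ a, w a = v (e a)) : gf w = gf v := by
  ext s
  rw [coeff_gf, coeff_gf]
  congr 1
  exact Nat.card_congr (e.subtypeEquiv (fun a => by rw [h]))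

theorem gf_shift {α : Type} (m : Fin 3 →₀ ℕ) (w : α → (Fin 3 →₀ ℕ)) (hw : FF w) :
    gf (fun a => m + w a) = MvPowerSeries.monomial m 1 * gf w := by
  rw [← gf_unit, ← gf_prod _ _ (fun s => inferInstance) hw]
  exact gf_equiv (Equiv.punitProd α).symm _ _ (fun a => rfl)

theorem gf_tree (w : BTree → (Fin 3 →₀ ℕ)) (hw : FF w) :
    gf w = MvPowerSeries.monomial (w leaf) 1 +
      gf (fun p : BTree × BTree => w (node p.1 p.2)) := by
  rw [← gf_unit]
  ext s
  rw [map_add, coeff_gf, coeff_gf, coeff_gf]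
  have e : {a : BTree // w a = s} ≃
      {a : Unit // w leaf = s} ⊕ {p : BTree × BTree // w (node p.1 p.2) = s} :=
    { toFun := fun a => match a with
        | ⟨leaf, h⟩ => Sum.inl ⟨(), h⟩
        | ⟨node l r, h⟩ => Sum.inr ⟨(l, r), h⟩
      invFun := fun z => match z with
        | Sum.inl a => ⟨leaf, a.2⟩
        | Sum.inr p => ⟨node p.1.1 p.1.2, p.2⟩
      left_inv := by rintro ⟨_ | _, h⟩ <;> rfl
      right_inv := by rintro (_ | _) <;> rfl }
  have := hw s
  have : Finite ({a : Unit // w leaf = s} ⊕ {p : BTree × BTree // w (node p.1 p.2) = s}) :=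
    Finite.of_equiv _ e
  have : Finite {p : BTree × BTree // w (node p.1 p.2) = s} :=
    Finite.of_injective (β := {a : Unit // w leaf = s} ⊕ {p : BTree × BTree // w (node p.1 p.2) = s})
      Sum.inr Sum.inr_injective
  rw [Nat.card_congr e, Nat.card_sum]
  push_cast
  rfl

theorem finite_V (n : ℕ) : {T : BTree | T.V < n}.Finite := by
  induction n with
  | zero => simp
  | succ n ih =>
    refine ((Set.finite_singleton leaf).union (Set.Finite.image2 node ih ih)).subset ?_
    rintro (_ | ⟨l, r⟩) h
    · left; rfl
    · right
      simp only [Set.mem_ofPred_eq, V] at h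
      exact ⟨l, by simp only [Set.mem_ofPred_eq]; omega, r,
        by simp only [Set.mem_ofPred_eq]; omega, rfl⟩

theorem ff_of_V (w : BTree → (Fin 3 →₀ ℕ)) (h : ∀ T, w T 0 = T.V) : FF w := by
  intro s
  have := (finite_V (s 0 + 1)).subset (t := {T | w T = s}) (by
    intro T hT
    have hT' : w T = s := hT
    simp only [Set.mem_ofPred_eq, ← h, hT']
    omega)
  exact this.to_subtype

open Finsupp in
/-- full weight -/
noncomputable def wF (T : BTree) : Fin 3 →₀ ℕ := single 0 T.V + single 1 T.D + single 2 T.J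

open Finsupp in
/-- weight without depth -/
noncomputable def wG (T : BTree) : Fin 3 →₀ ℕ := single 0 T.V + single 2 T.J

open Finsupp in
/-- weight of a left subtree -/
noncomputable def wA : BTree → (Fin 3 →₀ ℕ)
  | leaf => 0
  | node l r => single 2 1 + wG (node l r)

theorem ff_F : FF wF := ff_of_V _ (by intro T; simp [wF])
theorem ff_G : FF wG := ff_of_V _ (by intro T; simp [wG])
theorem ff_A : FF wA := ff_of_V _ (by intro T; cases T <;> simp [wA, wG, V])

open Finsupp in
theorem wF_node (l r : BTree) : wF (node l r) = (single 0 1 + single 1 1) + (wA l + wF r) := by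
  cases l <;> ext i <;> fin_cases i <;> simp [wF, wA, wG, V, D, J] <;> omega

open Finsupp in
theorem wG_node (l r : BTree) : wG (node l r) = single 0 1 + (wA l + wG r) := by
  cases l <;> ext i <;> fin_cases i <;> simp [wA, wG, V, J] <;> omega

theorem ff_prod {α β : Type} (w : α → (Fin 3 →₀ ℕ)) (v : β → (Fin 3 →₀ ℕ))
    (hw : FF w) (hv : FF v) : FF (fun p : α × β => w p.1 + v p.2) := by
  intro s
  have h1 : {a | w a ≤ s}.Finite := by
    have : {a | w a ≤ s} = ⋃ i ∈ Set.Iic s, {a | w a = i} := by ext; simp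
    rw [this]
    exact (Set.finite_Iic s).biUnion (fun i _ => Set.finite_coe_iff.mp (hw i))
  have h2 : {a | v a ≤ s}.Finite := by
    have : {a | v a ≤ s} = ⋃ i ∈ Set.Iic s, {a | v a = i} := by ext; simp
    rw [this]
    exact (Set.finite_Iic s).biUnion (fun i _ => Set.finite_coe_iff.mp (hv i))
  have h3 : {p : α × β | w p.1 + v p.2 = s} ⊆ {a | w a ≤ s} ×ˢ {a | v a ≤ s} := ?_
  · exact ((h1.prod h2).subset h3).to_subtype
  rintro p rfl
  exact ⟨show w p.1 ≤ w p.1 + v p.2 from le_self_add,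
    show v p.2 ≤ w p.1 + v p.2 from le_add_self⟩

theorem ff_node : FF (fun p : BTree × BTree => wG (node p.1 p.2)) := by
  intro s
  have := ff_G s
  refine Finite.of_injective (β := {T // wG T = s}) (fun p => ⟨node p.1.1 p.1.2, p.2⟩) ?_
  rintro ⟨⟨a, b⟩, _⟩ ⟨⟨c, d⟩, _⟩ h
  simpa using h

theorem eqF : gf wF = 1 + MvPowerSeries.X 1 * MvPowerSeries.X 0 * gf wA * gf wF := by
  conv_lhs => rw [gf_tree wF ff_F]
  simp only [wF_node]
  rw [gf_shift _ (fun p : BTree × BTree => wA p.1 + wF p.2) (ff_prod _ _ ff_A ff_F),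
    gf_prod _ _ ff_A ff_F]
  have h0 : wF leaf = 0 := by simp [wF, V, D, J]
  have h1 : (MvPowerSeries.monomial (Finsupp.single 0 1 + Finsupp.single 1 1) 1 :
      MvPowerSeries (Fin 3) ℚ) = MvPowerSeries.X 0 * MvPowerSeries.X 1 := by
    rw [MvPowerSeries.X, MvPowerSeries.X, MvPowerSeries.monomial_mul_monomial, one_mul]
  rw [h0, h1, MvPowerSeries.monomial_zero_one]
  ring

theorem eqG : gf wG = 1 + MvPowerSeries.X 0 * gf wA * gf wG := by
  conv_lhs => rw [gf_tree wG ff_G]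
  simp only [wG_node]
  rw [gf_shift _ (fun p : BTree × BTree => wA p.1 + wG p.2) (ff_prod _ _ ff_A ff_G),
    gf_prod _ _ ff_A ff_G]
  have h0 : wG leaf = 0 := by simp [wG, V, J]
  rw [h0, MvPowerSeries.monomial_zero_one, mul_assoc]
  rfl

theorem eqA : gf wA = 1 + MvPowerSeries.X 2 * (gf wG - 1) := by
  have h0 : wG leaf = 0 := by simp [wG, V, J]
  rw [gf_tree wA ff_A, gf_tree wG ff_G, h0, MvPowerSeries.monomial_zero_one]
  simp only [wA]
  rw [gf_shift _ (fun p : BTree × BTree => wG (node p.1 p.2)) ff_node,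
    MvPowerSeries.monomial_zero_one, add_sub_cancel_left]
  rfl

theorem F_eq : (fun s => (Nat.card {T : BTree // T.V = s 0 ∧ T.D = s 1 ∧ T.J = s 2} : ℚ)) =
    gf wF := by
  funext s
  unfold gf
  congr 1
  refine Nat.card_congr (Equiv.subtypeEquivRight fun T => ?_)
  rw [Finsupp.ext_iff, Fin.forall_fin_succ, Fin.forall_fin_two]
  simp [wF]

end BTree

/-- The trivariate weight-enumerator F(x,t,q) of full binary trees by
x^{V} t^{D} q^{J} satisfies the quadratic equation
(t·x·(q + t − 1) − t + 1)·F² + (t·x·(1 − q) + t − 2)·F + 1 = 0. -/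
theorem stmt_4 :
    let F : MvPowerSeries (Fin 3) ℚ :=
      fun s => (Nat.card {T : BTree // T.V = s 0 ∧ T.D = s 1 ∧ T.J = s 2} : ℚ)
    let x : MvPowerSeries (Fin 3) ℚ := MvPowerSeries.X 0
    let t : MvPowerSeries (Fin 3) ℚ := MvPowerSeries.X 1
    let q : MvPowerSeries (Fin 3) ℚ := MvPowerSeries.X 2
    (t * x * (q + t - 1) - t + 1) * F ^ 2 + (t * x * (1 - q) + t - 2) * F + 1 = 0 := by
  intro F x t q
  have hF : F = BTree.gf BTree.wF := BTree.F_eq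
  have e1 : F = 1 + t * x * BTree.gf BTree.wA * F := by rw [hF]; exact BTree.eqF
  have e2 := BTree.eqG
  have e3 := BTree.eqA
  change _ = 1 + x * _ * _ at e2
  change _ = 1 + q * _ at e3
  generalize BTree.gf BTree.wA = A at *
  generalize BTree.gf BTree.wG = G at *
  clear hF
  clear_value F x t q
  -- u = x * A
  have k1 : F * (1 - t * (x * A)) = 1 := by linear_combination e1
  have k2 : G * (1 - x * A) = 1 := by linear_combination e2
  have k3 : x - x * (x * A) * (1 - q) - x * A + (x * A) ^ 2 = 0 := by
    linear_combination (-x * (1 - x * A)) * e3 - x * q * k2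
  have k4 : (t * x * (q + t - 1) - t + 1) + (t * x * (1 - q) + t - 2) * (1 - t * (x * A))
      + (1 - t * (x * A)) ^ 2 = 0 := by
    linear_combination t ^ 2 * k3
  generalize 1 - t * (x * A) = c at *
  linear_combination F ^ 2 * k4 - ((t * x * (1 - q) + t - 2) * F + F * c + 1) * k1
end

section
/- Let H be the formal power series in variables x and q over ℚ whose coefficient of x^n q^j is the number of full binary trees T with V(T) = n and J(T) = j. Then H satisfies the quadratic equation q·x·H² − (1 − x + q·x)·H + 1 = 0. (This is the polynomial form of the explicit expression H(x,q) = −(−qx + √(q²x² − 2qx² − 2qx + x² − 2x + 1) + x − 1)/(2qx).) -/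
namespace BTreeAux

abbrev Ex := Fin 2 →₀ ℕ

/-- generating function of a weighted type -/
noncomputable def G {α : Type} (w : α → Ex) : MvPowerSeries (Fin 2) ℚ :=
  fun s => (Nat.card {a : α // w a = s} : ℚ)

def FinFib {α : Type} (w : α → Ex) : Prop := ∀ s, Finite {a : α // w a = s}

theorem coeff_G {α : Type} (w : α → Ex) (s : Ex) :
    MvPowerSeries.coeff s (G w) = (Nat.card {a : α // w a = s} : ℚ) := rfl

theorem G_equiv {α β : Type} (e : α ≃ β) (w : α → Ex) (v : β → Ex)
    (h : ∀ a, w a = v (e a)) : G w = G v := by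
  ext s
  rw [coeff_G, coeff_G, Nat.card_congr (e.subtypeEquiv (p := fun a => w a = s) (q := fun b => v b = s) (fun a => by rw [h a]))]

theorem G_sum {α β : Type} (w : α → Ex) (v : β → Ex) (hw : FinFib w) (hv : FinFib v) :
    G (Sum.elim w v) = G w + G v := by
  ext s
  have := hw s
  have := hv s
  rw [map_add, coeff_G, coeff_G, coeff_G, Nat.card_congr (Equiv.subtypeSum)]
  simp only [Sum.elim_inl, Sum.elim_inr]
  rw [Nat.card_sum]
  push_cast
  rfl

def prodEquiv {α β : Type} (w : α → Ex) (v : β → Ex) (s : Ex) :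
    {p : α × β // w p.1 + v p.2 = s} ≃
      Σ z : Finset.HasAntidiagonal.antidiagonal s, {a // w a = z.1.1} × {b // v b = z.1.2} where
  toFun p := ⟨⟨(w p.1.1, v p.1.2), by simpa using p.2⟩, ⟨p.1.1, rfl⟩, ⟨p.1.2, rfl⟩⟩
  invFun z := ⟨(z.2.1.1, z.2.2.1), by
    have := z.1.2
    rw [Finset.HasAntidiagonal.mem_antidiagonal] at this
    simp only [z.2.1.2, z.2.2.2, this]⟩
  left_inv p := rfl
  right_inv := by
    rintro ⟨⟨⟨c, d⟩, h⟩, ⟨a, ha⟩, ⟨b, hb⟩⟩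
    dsimp only at ha hb
    subst ha hb
    rfl

theorem FinFib_prod {α β : Type} (w : α → Ex) (v : β → Ex) (hw : FinFib w) (hv : FinFib v) :
    FinFib (fun p : α × β => w p.1 + v p.2) := by
  intro s
  have := hw
  have := hv
  unfold FinFib at *
  exact Finite.of_equiv _ (prodEquiv w v s).symm

theorem G_prod {α β : Type} (w : α → Ex) (v : β → Ex) (hw : FinFib w) (hv : FinFib v) :
    G (fun p : α × β => w p.1 + v p.2) = G w * G v := by
  ext s
  unfold FinFib at *
  rw [MvPowerSeries.coeff_mul, coeff_G, Nat.card_congr (prodEquiv w v s), Nat.card_sigma]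
  simp only [Nat.card_prod, coeff_G]
  push_cast
  exact Finset.sum_coe_sort (Finset.HasAntidiagonal.antidiagonal s)
    (fun z => (Nat.card {a // w a = z.1} : ℚ) * (Nat.card {b // v b = z.2} : ℚ))

theorem G_unit (m : Ex) : G (fun _ : Unit => m) = MvPowerSeries.monomial m 1 := by
  classical
  ext s
  rw [coeff_G, MvPowerSeries.coeff_monomial]
  split_ifs with h
  · subst h
    simp
  · have : IsEmpty {a : Unit // m = s} := ⟨fun a => h a.2.symm⟩
    simp

theorem FinFib_unit (m : Ex) : FinFib (fun _ : Unit => m) := fun _ => inferInstance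

theorem G_shift {α : Type} (m : Ex) (w : α → Ex) (hw : FinFib w) :
    G (fun a => m + w a) = MvPowerSeries.monomial m 1 * G w := by
  rw [← G_unit, ← G_prod _ _ (FinFib_unit m) hw]
  exact G_equiv (Equiv.punitProd α).symm _ _ (fun a => rfl)

theorem FinFib_shift {α : Type} (m : Ex) (w : α → Ex) (hw : FinFib w) :
    FinFib (fun a => m + w a) := by
  intro s
  have := hw (s - m)
  refine Finite.of_injective
    (fun a : {a : α // m + w a = s} => (⟨a.1, by have := a.2; rw [eq_comm] at this; simp [this]⟩ : {a : α // w a = s - m})) ?_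
  rintro ⟨a, ha⟩ ⟨b, hb⟩ h
  simpa using h

noncomputable def wt (T : BTree) : Ex := Finsupp.single 0 T.V + Finsupp.single 1 T.J

theorem wt_eq_iff (T : BTree) (s : Ex) : wt T = s ↔ T.V = s 0 ∧ T.J = s 1 := by
  rw [Finsupp.ext_iff, Fin.forall_fin_two]
  simp [wt]

theorem finite_V (n : ℕ) : {T : BTree | T.V ≤ n}.Finite := by
  induction n with
  | zero =>
    refine (Set.finite_singleton BTree.leaf).subset ?_
    rintro (_ | ⟨l, r⟩) h
    · rfl
    · simp [BTree.V] at h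
  | succ n ih =>
    refine ((Set.finite_singleton BTree.leaf).union (ih.image2 BTree.node ih)).subset ?_
    rintro (_ | ⟨l, r⟩) h
    · left; rfl
    · right
      simp only [BTree.V, Set.mem_ofPred_eq] at h
      exact ⟨l, by simp only [Set.mem_ofPred_eq]; omega, r, by simp only [Set.mem_ofPred_eq]; omega, rfl⟩

theorem FinFib_wt : FinFib wt := by
  intro s
  refine Set.Finite.to_subtype ((finite_V (s 0)).subset ?_)
  intro T (h : wt T = s)
  exact ((wt_eq_iff T s).1 h).1.le

noncomputable def wn (p : BTree × BTree) : Ex := wt (BTree.node p.1 p.2)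

theorem FinFib_wn : FinFib wn := by
  intro s
  have := FinFib_wt s
  refine Finite.of_injective
    (fun a : {a // wn a = s} => (⟨BTree.node a.1.1 a.1.2, a.2⟩ : {a // wt a = s})) ?_
  rintro ⟨⟨a, b⟩, ha⟩ ⟨⟨c, d⟩, hb⟩ h
  have hval := congrArg Subtype.val h
  simpa using hval

def e1 : BTree ≃ Unit ⊕ (BTree × BTree) where
  toFun
    | .leaf => .inl ()
    | .node l r => .inr (l, r)
  invFun
    | .inl _ => .leaf
    | .inr p => .node p.1 p.2
  left_inv := by rintro (_ | _) <;> rfl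
  right_inv := by rintro (_ | _) <;> rfl

def e2 : BTree × BTree ≃ BTree ⊕ ((BTree × BTree) × BTree) where
  toFun
    | (.leaf, r) => .inl r
    | (.node a b, r) => .inr ((a, b), r)
  invFun
    | .inl r => (.leaf, r)
    | .inr p => (.node p.1.1 p.1.2, p.2)
  left_inv := by rintro ⟨_ | _, _⟩ <;> rfl
  right_inv := by rintro (_ | _) <;> rfl

theorem eq1 : G wt = 1 + G wn := by
  rw [G_equiv e1 wt (Sum.elim (fun _ => 0) wn), G_sum _ _ (FinFib_unit 0) FinFib_wn, G_unit]
  · rfl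
  · rintro (_ | ⟨l, r⟩)
    · simp [e1, wt, BTree.V, BTree.J]
    · rfl

theorem eq2 : G wn = MvPowerSeries.X 0 * G wt +
    MvPowerSeries.X 1 * MvPowerSeries.X 0 * (G wn * G wt) := by
  have hp := FinFib_prod wn wt FinFib_wn FinFib_wt
  refine (G_equiv e2 wn (Sum.elim (fun T => Finsupp.single 0 1 + wt T)
    (fun p => (Finsupp.single 1 1 + Finsupp.single 0 1) + (wn p.1 + wt p.2))) ?_).trans ?_
  rotate_left
  · rw [G_sum _ _ (FinFib_shift _ _ FinFib_wt) (FinFib_shift _ _ hp), G_shift _ _ FinFib_wt,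
    G_shift _ _ hp, G_prod _ _ FinFib_wn FinFib_wt]
    rw [MvPowerSeries.X, MvPowerSeries.X, MvPowerSeries.monomial_mul_monomial, one_mul]
  · rintro ⟨_ | ⟨a, b⟩, r⟩
    · rw [wn, wt_eq_iff]
      simp [e2, wt, BTree.V, BTree.J]
      omega
    · rw [wn, wt_eq_iff]
      simp [e2, wn, wt, BTree.V, BTree.J]
      omega

end BTreeAux

/-- The bivariate weight-enumerator H(x,q) of full binary trees by
x^{V} q^{J} satisfies q·x·H² − (1 − x + q·x)·H + 1 = 0. -/
theorem stmt_5 :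
    let H : MvPowerSeries (Fin 2) ℚ :=
      fun s => (Nat.card {T : BTree // T.V = s 0 ∧ T.J = s 1} : ℚ)
    let x : MvPowerSeries (Fin 2) ℚ := MvPowerSeries.X 0
    let q : MvPowerSeries (Fin 2) ℚ := MvPowerSeries.X 1
    q * x * H ^ 2 - (1 - x + q * x) * H + 1 = 0 := by
  intro H x q
  have hH : H = BTreeAux.G BTreeAux.wt := by
    funext s
    simp only [H, BTreeAux.G, BTreeAux.wt_eq_iff]
  have h1 := BTreeAux.eq1
  have h2 := BTreeAux.eq2
  rw [← hH] at h1 h2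
  have h3 : BTreeAux.G BTreeAux.wn = H - 1 := by rw [h1]; ring
  rw [h3] at h2
  change H - 1 = x * H + q * x * ((H - 1) * H) at h2
  linear_combination -h2
end

section
/- For all n ≥ 0 and d ≥ 0, the number of full binary trees T with V(T) = n and D(T) = d equals the number of d-tuples (T_1, ..., T_d) of full binary trees with V(T_1) + ... + V(T_d) = n − d (in particular it is 0 when d > n); equivalently, B(n,d) = Σ_{k_1 + ... + k_d = n−d} b_{k_1}···b_{k_d}. (This is the coefficient form of the explicit expression J(x,t) = 2/(t·√(1−4x) − t + 2) = 1/(1 − x·t·f(x)), where f is the Catalan generating function.) -/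
namespace BTree

/-- The tree whose right spine carries the left subtrees `f 0, …, f (d-1)`. -/
def comb : (d : ℕ) → (Fin d → BTree) → BTree
  | 0, _ => leaf
  | d + 1, f => node (f 0) (comb d (fun i => f i.succ))

theorem V_comb : ∀ (d : ℕ) (f : Fin d → BTree), (comb d f).V = (∑ i, (f i).V) + d
  | 0, f => by simp [comb, V]
  | d + 1, f => by
    simp only [comb, V, V_comb d, Fin.sum_univ_succ]
    omega

theorem D_comb : ∀ (d : ℕ) (f : Fin d → BTree), (comb d f).D = d
  | 0, f => rfl
  | d + 1, f => by
    simp only [comb, D, D_comb d]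
    omega

theorem comb_inj : ∀ (d : ℕ) (f g : Fin d → BTree), comb d f = comb d g → f = g
  | 0, f, g, _ => Subsingleton.elim f g
  | d + 1, f, g, h => by
    simp only [comb, node.injEq] at h
    have h2 := comb_inj d _ _ h.2
    funext i
    refine Fin.cases h.1 (fun j => ?_) i
    exact congrFun h2 j

theorem comb_surj : ∀ T : BTree, ∃ f : Fin T.D → BTree, comb T.D f = T
  | leaf => ⟨fun _ => leaf, rfl⟩
  | node l r => by
    obtain ⟨f, hf⟩ := comb_surj r
    have h : (node l r).D = r.D + 1 := by simp only [D]; omega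
    rw [h]
    exact ⟨Fin.cons l f, by simp [comb, hf]⟩

end BTree

/-- The number of full binary trees with V = n and D = d equals the number of
d-tuples (T₁, …, T_d) of full binary trees with V(T₁) + ⋯ + V(T_d) = n − d
(in particular it is 0 when d > n). -/
theorem stmt_7 (n d : ℕ) :
    Nat.card {T : BTree // T.V = n ∧ T.D = d} =
      Nat.card {f : Fin d → BTree // (∑ i, (f i).V) + d = n} := by
  symm
  refine Nat.card_eq_of_bijective
    (fun f => ⟨BTree.comb d f.1, (BTree.V_comb d f.1).trans f.2, BTree.D_comb d f.1⟩) ⟨?_, ?_⟩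
  · intro f g h
    exact Subtype.ext (BTree.comb_inj d _ _ (congrArg Subtype.val h))
  · rintro ⟨T, hV, hD⟩
    subst hD
    obtain ⟨f, hf⟩ := BTree.comb_surj T
    refine ⟨⟨f, ?_⟩, Subtype.ext hf⟩
    rw [← BTree.V_comb, hf, hV]
end

section
/- For every n ≥ 1, the sum of J(T) over all full binary trees T with V(T) = n satisfies 2·Σ_{V(T)=n} J(T) = (n − 1)·b_n; equivalently, the expected number of jumps among all full binary trees with n internal vertices is (n−1)/2. -/
namespace BTree

/-- left-right reflection -/
def mir : BTree → BTree
  | leaf => leaf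
  | node l r => node (mir r) (mir l)

theorem mir_mir (T : BTree) : T.mir.mir = T := by
  induction T with
  | leaf => rfl
  | node l r hl hr => simp [mir, hl, hr]

theorem V_mir (T : BTree) : T.mir.V = T.V := by
  induction T with
  | leaf => rfl
  | node l r hl hr => simp [mir, V, hl, hr, add_comm]

theorem J_add_J_mir (T : BTree) : T.J + T.mir.J = T.V - 1 := by
  induction T with
  | leaf => rfl
  | node l r hl hr =>
    cases l <;> cases r <;> simp only [mir, V, J] at * <;> omega

theorem finite_V_le (n : ℕ) : {T : BTree | T.V ≤ n}.Finite := by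
  induction n with
  | zero =>
    refine (Set.finite_singleton leaf).subset ?_
    rintro (_ | ⟨l, r⟩) h
    · rfl
    · simp [V] at h
  | succ n ih =>
    refine ((ih.image2 node ih).insert leaf).subset ?_
    rintro (_ | ⟨l, r⟩) h
    · exact Set.mem_insert _ _
    · simp only [V, Set.mem_setOf_eq] at h
      exact Set.mem_insert_of_mem _ (Set.mem_image2_of_mem
        (show l.V ≤ n by omega) (show r.V ≤ n by omega))

end BTree

/-- The expected number of jumps among full binary trees with n ≥ 1 internal
vertices is (n−1)/2: twice the total number of jumps equals (n−1)·bₙ. -/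
theorem stmt_9 (n : ℕ) (hn : 1 ≤ n) :
    2 * (∑ᶠ T ∈ {T : BTree | T.V = n}, T.J) =
      (n - 1) * Nat.card {T : BTree // T.V = n} := by
  have hf : {T : BTree | T.V = n}.Finite :=
    (BTree.finite_V_le n).subset fun T h => le_of_eq h
  have hc : Nat.card {T : BTree // T.V = n} = hf.toFinset.card :=
    Nat.card_eq_card_finite_toFinset hf
  rw [hc, finsum_mem_eq_finite_toFinset_sum _ hf, two_mul]
  have hm : ∑ T ∈ hf.toFinset, T.J = ∑ T ∈ hf.toFinset, T.mir.J := by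
    refine Finset.sum_nbij' BTree.mir BTree.mir ?_ ?_ ?_ ?_ ?_ <;>
      simp [BTree.mir_mir, BTree.V_mir]
  conv_lhs => rw [hm]; arg 1; rw [← hm]
  rw [← Finset.sum_add_distrib, mul_comm, ← smul_eq_mul]
  refine Finset.sum_eq_card_nsmul fun T hT => ?_
  rw [BTree.J_add_J_mir]
  have : T.V = n := by simpa using hT
  rw [this]
end
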